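/- In the setting of the implicit leap-frog all-at-once matrix 𝐀 and block α-circulant preconditioner P_α with A symmetric positive definite, take α = 1 and assume e^{i N_t θ_j} ≠ 1 for all j = 1,…,N_x, where θ_j = arctan(√(λ_j² − 1)) and λ_j are the eigenvalues of D = I_x + (Δt²/2)A. Then P_1 is invertible and σ(P_1^{-1}𝐀) = {1} ∪ { 1/2 + (i/2)·cot(N_t θ_j/2), 1/2 − (i/2)·cot(N_t θ_j/2) : j = 1,…,N_x }. -/

import Mathlib

open Matrix Polynomial
open scoped Kronecker

/-- The down-shift matrix `S` (entries `S_{j+1,j} = 1`, 0-based: `S j k = 1` iff `j = k+1`). -/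
noncomputable def downShift (N : ℕ) : Matrix (Fin N) (Fin N) ℂ :=
  Matrix.of fun j k : Fin N => if (j : ℕ) = (k : ℕ) + 1 then (1 : ℂ) else 0

/-- The α-shift matrix `S_α = S + α E_{1,N}`, where `E_{1,N}` has a single `1` in the
top-right corner. -/
noncomputable def downShiftAlpha (N : ℕ) (α : ℂ) : Matrix (Fin N) (Fin N) ℂ :=
  downShift N +
    α • Matrix.of fun j k : Fin N => if (j : ℕ) = 0 ∧ (k : ℕ) + 1 = N then (1 : ℂ) else 0

/-- The matrix unit with a single `1` in the top-right corner. -/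
def topRightCorner (N : ℕ) : Matrix (Fin N) (Fin N) ℂ :=
  Matrix.of fun j k : Fin N => if (j : ℕ) = 0 ∧ (k : ℕ) + 1 = N then (1 : ℂ) else 0

theorem downShiftAlpha_eq (N : ℕ) (α : ℂ) :
    downShiftAlpha N α = downShift N + α • topRightCorner N := rfl

theorem topRightCorner_mul_self {N : ℕ} (hN : 2 ≤ N) :
    topRightCorner N * topRightCorner N = 0 := by
  ext i k
  refine (Matrix.mul_apply ..).trans (Finset.sum_eq_zero fun j _ => ?_)
  simp only [topRightCorner, Matrix.of_apply, mul_ite, mul_one, mul_zero]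
  split_ifs <;> first | rfl | omega

theorem downShiftAlpha_sq {N : ℕ} (hN : 2 ≤ N) (α : ℂ) :
    downShiftAlpha N α ^ 2 = downShift N ^ 2 +
      α • (downShift N * topRightCorner N + topRightCorner N * downShift N) := by
  simp only [downShiftAlpha_eq, sq, add_mul, mul_add, Matrix.smul_mul, Matrix.mul_smul,
    topRightCorner_mul_self hN, smul_zero, add_zero, smul_add]
  abel

theorem topRightCorner_apply_zero {n : ℕ} (i : Fin (n + 3)) : topRightCorner (n + 3) i 0 = 0 := by
  simp [topRightCorner]

theorem topRightCorner_anticommutator_apply_zero {n : ℕ} (i : Fin (n + 3)) :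
    (downShift (n + 3) * topRightCorner (n + 3) + topRightCorner (n + 3) * downShift (n + 3)) i 0
      = 0 := by
  rw [Matrix.add_apply, Matrix.mul_apply, Matrix.mul_apply, Finset.sum_eq_zero,
    Finset.sum_eq_zero, add_zero]
  · intro j _
    simp only [topRightCorner, downShift, Matrix.of_apply]
    split_ifs with hj h1
    · rw [Fin.val_zero] at h1
      omega
    all_goals simp only [mul_zero, zero_mul]
  · intro j _
    rw [topRightCorner_apply_zero, mul_zero]

theorem downShiftAlpha_mulVec_zero {n : ℕ} (α : ℂ) (v : Fin (n + 1) → ℂ) :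
    (downShiftAlpha (n + 1) α *ᵥ v) 0 = α * v (Fin.last n) := by
  rw [Matrix.mulVec, dotProduct, Finset.sum_eq_single (Fin.last n)]
  · simp [downShiftAlpha, downShift]
  · intro j _ hj
    have : (j : ℕ) ≠ n := fun h => hj (Fin.ext h)
    simp [downShiftAlpha, downShift, this]
  · simp

theorem downShiftAlpha_mulVec_succ {n : ℕ} (α : ℂ) (v : Fin (n + 1) → ℂ) (i : Fin n) :
    (downShiftAlpha (n + 1) α *ᵥ v) i.succ = v i.castSucc := by
  rw [Matrix.mulVec, dotProduct, Finset.sum_eq_single i.castSucc]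
  · simp [downShiftAlpha, downShift]
  · intro j _ hj
    have : ¬ (i : ℕ) = j := fun h => hj (Fin.ext h.symm)
    simp [downShiftAlpha, downShift, this]
  · simp

theorem det_one_sub_smul_downShiftAlpha_eq_zero_iff {N : ℕ} (hN : 1 ≤ N) (w α : ℂ) :
    (1 - w • downShiftAlpha N α).det = 0 ↔ w ^ N * α = 1 := by
  obtain ⟨n, rfl⟩ := Nat.exists_eq_add_of_le' hN
  rw [← Matrix.exists_mulVec_eq_zero_iff]
  simp only [Matrix.sub_mulVec, Matrix.one_mulVec, Matrix.smul_mulVec, sub_eq_zero]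
  constructor
  · rintro ⟨v, hv, h⟩
    have hpow : ∀ i : Fin (n + 1), v i = w ^ (i : ℕ) * v 0 := by
      intro i
      induction i using Fin.induction with
      | zero => simp
      | succ i ih =>
        have hi := congrFun h i.succ
        rw [Pi.smul_apply, downShiftAlpha_mulVec_succ, ih] at hi
        rw [hi, smul_eq_mul, Fin.val_castSucc, Fin.val_succ]
        ring
    have h0 := congrFun h 0
    rw [Pi.smul_apply, downShiftAlpha_mulVec_zero, hpow (Fin.last n), smul_eq_mul,
      Fin.val_last] at h0
    have hv0 : v 0 ≠ 0 := fun hz => hv <| funext fun i => by simp [hpow i, hz]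
    apply mul_right_cancel₀ hv0
    linear_combination -h0
  · intro h
    refine ⟨fun i => w ^ (i : ℕ), fun h0 => by simpa using congrFun h0 0, funext fun i => ?_⟩
    rw [Pi.smul_apply]
    cases i using Fin.cases with
    | zero =>
      rw [downShiftAlpha_mulVec_zero, smul_eq_mul, Fin.val_last, Fin.val_zero, pow_zero, ← h]
      ring
    | succ i =>
      rw [downShiftAlpha_mulVec_succ, smul_eq_mul, Fin.val_castSucc, Fin.val_succ]
      ring

/-- When `l cos t = 1`, `l (1 + S_α²) - 2 S_α` is singular iff `α = exp (± i N t)`. -/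
theorem det_quadratic_downShiftAlpha_eq_zero_iff {N : ℕ} (hN : 1 ≤ N) (α : ℂ) {l t : ℝ}
    (hl : l * Real.cos t = 1) :
    ((l : ℂ) • (1 + downShiftAlpha N α ^ 2) - (2 : ℂ) • downShiftAlpha N α).det = 0 ↔
      α = Complex.exp (Complex.I * N * t) ∨ α = Complex.exp (-(Complex.I * N * t)) := by
  have hl0 : (l : ℂ) ≠ 0 := by
    rintro h
    simp [Complex.ofReal_eq_zero.mp h] at hl
  set w := Complex.exp (Complex.I * t) with hw
  set w' := Complex.exp (-(Complex.I * t)) with hw'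
  have hww : w * w' = 1 := by rw [hw, hw', ← Complex.exp_add, add_neg_cancel, Complex.exp_zero]
  have hsum : (l : ℂ) * (w + w') = 2 := by
    have : w + w' = 2 * Complex.cos t := by
      rw [Complex.cos, hw, hw']
      ring_nf
    rw [this, ← Complex.ofReal_cos]
    have hl' : (l : ℂ) * (Real.cos t : ℂ) = 1 := by exact_mod_cast hl
    linear_combination 2 * hl'
  have hfac : (l : ℂ) • (1 + downShiftAlpha N α ^ 2) - (2 : ℂ) • downShiftAlpha N α =
      (l : ℂ) • ((1 - w • downShiftAlpha N α) * (1 - w' • downShiftAlpha N α)) := by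
    have hcombine : (1 - w • downShiftAlpha N α) * (1 - w' • downShiftAlpha N α) =
        1 - (w + w') • downShiftAlpha N α + (w * w') • downShiftAlpha N α ^ 2 := by
      simp only [sub_mul, mul_sub, one_mul, mul_one, Matrix.smul_mul, Matrix.mul_smul, smul_smul,
        ← sq]
      module
    rw [hcombine, hww, one_smul, ← hsum]
    module
  have hexp : Complex.exp (Complex.I * N * t) = w ^ N := by
    rw [hw, ← Complex.exp_nat_mul]
    ring_nf
  have hexp' : Complex.exp (-(Complex.I * N * t)) = w' ^ N := by
    rw [hw', ← Complex.exp_nat_mul]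
    ring_nf
  have hwwN : w ^ N * w' ^ N = 1 := by rw [← mul_pow, hww, one_pow]
  rw [hfac, Matrix.det_smul, Matrix.det_mul, mul_eq_zero, mul_eq_zero,
    or_iff_right (pow_ne_zero _ hl0), det_one_sub_smul_downShiftAlpha_eq_zero_iff hN,
    det_one_sub_smul_downShiftAlpha_eq_zero_iff hN, hexp, hexp', or_comm]
  refine or_congr ⟨fun h => ?_, fun h => ?_⟩ ⟨fun h => ?_, fun h => ?_⟩
  · linear_combination w ^ N * h - α * hwwN
  · rw [h, mul_comm, hwwN]
  · linear_combination w' ^ N * h - α * hwwN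
  · rw [h, hwwN]

theorem det_kronecker_one_add_kronecker_of_isHermitian {m n : Type*} [Fintype m] [DecidableEq m]
    [Fintype n] [DecidableEq n] (M K : Matrix m m ℂ) {D : Matrix n n ℂ} (hD : D.IsHermitian)
    {l : n → ℂ} (hl : D.charpoly = ∏ j, (X - C (l j))) :
    (M ⊗ₖ (1 : Matrix n n ℂ) + K ⊗ₖ D).det = ∏ j, (M + l j • K).det := by
  set d : n → ℂ := fun j => (hD.eigenvalues j : ℂ) with hd
  have hroots : Finset.univ.val.map d = Finset.univ.val.map l := by
    have h := hD.roots_charpoly_eq_eigenvalues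
    rw [hl, Polynomial.roots_prod _ _
      (Finset.prod_ne_zero_iff.mpr fun j _ => X_sub_C_ne_zero _)] at h
    simpa using h.symm
  have hprod : ∏ j, (M + d j • K).det = ∏ j, (M + l j • K).det := by
    have h := congrArg (fun s => (s.map fun x => (M + x • K).det).prod) hroots
    rwa [Multiset.map_map, Multiset.map_map] at h
  set U : Matrix n n ℂ := (hD.eigenvectorUnitary).1 with hU
  have hUU : U * star U = 1 := Unitary.mul_star_self_of_mem hD.eigenvectorUnitary.2
  have hdiag : D = U * diagonal d * star U := hD.spectral_theorem
  have hconj : M ⊗ₖ (1 : Matrix n n ℂ) + K ⊗ₖ D =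
      ((1 : Matrix m m ℂ) ⊗ₖ U) * blockDiagonal (fun j => M + d j • K) *
        ((1 : Matrix m m ℂ) ⊗ₖ star U) := by
    have hblock : blockDiagonal (fun j => M + d j • K) =
        M ⊗ₖ (1 : Matrix n n ℂ) + K ⊗ₖ diagonal d := by
      rw [kronecker_one, kronecker_diagonal, ← blockDiagonal_add]
      congr 1
      ext j a b
      simp [mul_comm]
    rw [hblock, mul_add, add_mul, ← mul_kronecker_mul, ← mul_kronecker_mul, ← mul_kronecker_mul,
      ← mul_kronecker_mul, one_mul, one_mul, mul_one, mul_one, mul_one, hUU, ← hdiag]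
  have hdet : ((1 : Matrix m m ℂ) ⊗ₖ U).det * ((1 : Matrix m m ℂ) ⊗ₖ star U).det = 1 := by
    rw [← det_mul, ← mul_kronecker_mul, one_mul, hUU, one_kronecker_one, det_one]
  rw [hconj, det_mul, det_mul, det_blockDiagonal, hprod, mul_right_comm, hdet, one_mul]

/-- The block `α`-circulant implicit leap-frog matrix; `α = 0` is the all-at-once matrix. -/
noncomputable def leapfrogPreconditioner {n : Type*} [DecidableEq n] (N : ℕ) (τ : ℂ)
    (B : Matrix n n ℂ) (α : ℂ) : Matrix (Fin N × n) (Fin N × n) ℂ :=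
  (1 / τ ^ 2) • (((1 - downShiftAlpha N α) ^ 2) ⊗ₖ (1 : Matrix n n ℂ)) +
    (1 / 2 : ℂ) • ((1 + downShiftAlpha N α ^ 2) ⊗ₖ B)

section leapfrogPreconditioner

variable {n : Type*} [DecidableEq n]

theorem leapfrogPreconditioner_eq_add_smul {N : ℕ} (hN : 2 ≤ N) (τ : ℂ) (B : Matrix n n ℂ)
    (α : ℂ) :
    leapfrogPreconditioner N τ B α = leapfrogPreconditioner N τ B 0 +
      α • ((1 / τ ^ 2) • ((downShift N * topRightCorner N + topRightCorner N * downShift N -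
          (2 : ℂ) • topRightCorner N) ⊗ₖ (1 : Matrix n n ℂ)) +
        (1 / 2 : ℂ) • ((downShift N * topRightCorner N + topRightCorner N * downShift N) ⊗ₖ B)) := by
  have hsq (β : ℂ) : (1 - downShiftAlpha N β) ^ 2 = (1 - downShift N) ^ 2 +
      β • (downShift N * topRightCorner N + topRightCorner N * downShift N -
        (2 : ℂ) • topRightCorner N) := by
    have h (X : Matrix (Fin N) (Fin N) ℂ) : (1 - X) ^ 2 = 1 - (2 : ℂ) • X + X ^ 2 := by
      rw [two_smul]
      noncomm_ring
    rw [h, h, downShiftAlpha_sq hN, downShiftAlpha_eq]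
    module
  simp only [leapfrogPreconditioner, hsq, downShiftAlpha_sq hN, ← add_assoc, add_kronecker,
    smul_kronecker, zero_smul, add_zero]
  module

theorem smul_leapfrogPreconditioner_sub {N : ℕ} (hN : 2 ≤ N) (τ : ℂ) (B : Matrix n n ℂ)
    {z : ℂ} (hz : z ≠ 1) :
    z • leapfrogPreconditioner N τ B 1 - leapfrogPreconditioner N τ B 0 =
      (z - 1) • leapfrogPreconditioner N τ B (z / (z - 1)) := by
  have hz' : z - 1 ≠ 0 := sub_ne_zero.mpr hz
  rw [leapfrogPreconditioner_eq_add_smul hN τ B 1,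
    leapfrogPreconditioner_eq_add_smul hN τ B (z / (z - 1)), smul_add (z - 1), smul_smul (z - 1),
    mul_div_cancel₀ _ hz']
  module

theorem det_leapfrogPreconditioner_one_sub_zero [Fintype n] [Nonempty n] {N : ℕ} (hN : 3 ≤ N)
    (τ : ℂ) (B : Matrix n n ℂ) :
    (leapfrogPreconditioner N τ B 1 - leapfrogPreconditioner N τ B 0).det = 0 := by
  obtain ⟨k, rfl⟩ := Nat.exists_eq_add_of_le' hN
  refine det_eq_zero_of_column_eq_zero (0, Classical.arbitrary n) fun i => ?_
  rw [leapfrogPreconditioner_eq_add_smul (by omega) τ B 1, add_sub_cancel_left]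
  rw [one_smul, Matrix.add_apply, Matrix.smul_apply, Matrix.smul_apply, kronecker_apply,
    kronecker_apply, Matrix.sub_apply, Matrix.smul_apply]
  simp [-Matrix.add_apply, topRightCorner_anticommutator_apply_zero, topRightCorner_apply_zero]

theorem det_leapfrogPreconditioner_eq_zero_iff [Fintype n] {N : ℕ} (hN : 1 ≤ N) {τ : ℂ}
    (hτ : τ ≠ 0) {B : Matrix n n ℂ} (hB : (1 + (τ ^ 2 / 2) • B).IsHermitian) {l t : n → ℝ}
    (hl : (1 + (τ ^ 2 / 2) • B).charpoly = ∏ j, (X - C (l j : ℂ)))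
    (hlt : ∀ j, l j * Real.cos (t j) = 1) (α : ℂ) :
    (leapfrogPreconditioner N τ B α).det = 0 ↔
      ∃ j, α = Complex.exp (Complex.I * N * t j) ∨ α = Complex.exp (-(Complex.I * N * t j)) := by
  have hP : leapfrogPreconditioner N τ B α = (1 / τ ^ 2) •
      ((-(2 : ℂ) • downShiftAlpha N α) ⊗ₖ (1 : Matrix n n ℂ) +
        (1 + downShiftAlpha N α ^ 2) ⊗ₖ (1 + (τ ^ 2 / 2) • B)) := by
    have h : (1 - downShiftAlpha N α) ^ 2 =
        (-(2 : ℂ) • downShiftAlpha N α) + (1 + downShiftAlpha N α ^ 2) := by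
      rw [neg_smul, two_smul]
      noncomm_ring
    have hτ2 : (1 / τ ^ 2) * (τ ^ 2 / 2) = 1 / 2 := by field_simp
    rw [leapfrogPreconditioner, h, kronecker_add, add_kronecker, kronecker_smul, ← hτ2]
    module
  rw [hP, det_smul, mul_eq_zero, or_iff_right (pow_ne_zero _ (one_div_ne_zero (pow_ne_zero 2 hτ))),
    det_kronecker_one_add_kronecker_of_isHermitian _ _ hB hl, Finset.prod_eq_zero_iff]
  simp only [Finset.mem_univ, true_and, neg_smul, neg_add_eq_sub,
    det_quadratic_downShiftAlpha_eq_zero_iff hN α (hlt _)]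

end leapfrogPreconditioner

theorem half_sub_cot_eq {x : ℝ} (hx : Complex.exp (Complex.I * x) ≠ 1) :
    (1 / 2 - Complex.I / 2 * (Real.cot (x / 2) : ℝ) : ℂ) =
      Complex.exp (Complex.I * x) / (Complex.exp (Complex.I * x) - 1) := by
  have hcot : Complex.exp (2 * Complex.I * ((x / 2 : ℝ) : ℂ)) = Complex.exp (Complex.I * x) := by
    push_cast
    ring_nf
  rw [Complex.ofReal_cot, Complex.cot_eq_exp_ratio, hcot]
  have h1 := sub_ne_zero.mpr hx
  have h2 := sub_ne_zero.mpr hx.symm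
  have hI := Complex.I_ne_zero
  field_simp
  ring

theorem half_add_cot_eq {x : ℝ} (hx : Complex.exp (-(Complex.I * x)) ≠ 1) :
    (1 / 2 + Complex.I / 2 * (Real.cot (x / 2) : ℝ) : ℂ) =
      Complex.exp (-(Complex.I * x)) / (Complex.exp (-(Complex.I * x)) - 1) := by
  have hneg : -(Complex.I * x) = Complex.I * ((-x : ℝ) : ℂ) := by
    push_cast
    ring
  have hcot : Real.cot (-x / 2) = -Real.cot (x / 2) := by
    rw [neg_div, Real.cot_eq_cos_div_sin, Real.cot_eq_cos_div_sin, Real.cos_neg, Real.sin_neg,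
      div_neg]
  rw [hneg] at hx ⊢
  rw [← half_sub_cot_eq hx, hcot]
  push_cast
  ring

theorem div_sub_one_eq_iff {K : Type*} [Field K] {z c : K} (hz : z ≠ 1) (hc : c ≠ 1) :
    z / (z - 1) = c ↔ z = c / (c - 1) := by
  rw [div_eq_iff (sub_ne_zero.mpr hz), eq_div_iff (sub_ne_zero.mpr hc)]
  constructor <;> intro h <;> linear_combination -h

theorem mul_cos_arctan_sqrt {l : ℝ} (hl : 1 ≤ l) :
    l * Real.cos (Real.arctan (Real.sqrt (l ^ 2 - 1))) = 1 := by
  rw [Real.cos_arctan, Real.sq_sqrt (by nlinarith), add_sub_cancel, Real.sqrt_sq (by linarith)]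
  field_simp

/-- For the implicit leap-frog all-at-once matrix `𝐀` and block circulant
preconditioner `P₁` (case `α = 1`) with `A` symmetric positive definite, assuming
`e^{iN_tθ_j} ≠ 1` for all `j`, the preconditioner is invertible and
`σ(P₁⁻¹𝐀) = {1} ∪ {1/2 ± (i/2)cot(N_tθ_j/2)}`. -/
theorem paraDiagII_leapfrog_spectrum_alpha_one (Nx Nt : ℕ) (hNx : 1 ≤ Nx) (hNt : 3 ≤ Nt)
    (A : Matrix (Fin Nx) (Fin Nx) ℝ) (hA : A.PosDef)
    (Δt : ℝ) (hΔt : 0 < Δt)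
    (lam : Fin Nx → ℝ)
    (hlam : ((1 : Matrix (Fin Nx) (Fin Nx) ℝ) + (Δt ^ 2 / 2) • A).charpoly =
      ∏ j, (X - C (lam j)))
    (hlam1 : ∀ j, 1 < lam j)
    (θ : Fin Nx → ℝ) (hθ : ∀ j, θ j = Real.arctan (Real.sqrt ((lam j) ^ 2 - 1)))
    (hne : ∀ j : Fin Nx, Complex.exp (Complex.I * Nt * (θ j : ℝ)) ≠ 1) :
    let Ix : Matrix (Fin Nx) (Fin Nx) ℂ := 1
    let Ac : Matrix (Fin Nx) (Fin Nx) ℂ := A.map Complex.ofReal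
    let AA := (1 / (Δt : ℂ) ^ 2) • (((1 - downShift Nt) ^ 2) ⊗ₖ Ix) +
              (1 / 2 : ℂ) • ((1 + downShift Nt ^ 2) ⊗ₖ Ac)
    let P1 := (1 / (Δt : ℂ) ^ 2) • (((1 - downShiftAlpha Nt 1) ^ 2) ⊗ₖ Ix) +
              (1 / 2 : ℂ) • ((1 + downShiftAlpha Nt 1 ^ 2) ⊗ₖ Ac)
    IsUnit P1 ∧
      spectrum ℂ (P1⁻¹ * AA) =
        {1} ∪ {z : ℂ | ∃ j : Fin Nx,
          z = 1 / 2 + (Complex.I / 2) * (Real.cot (Nt * θ j / 2) : ℝ) ∨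
          z = 1 / 2 - (Complex.I / 2) * (Real.cot (Nt * θ j / 2) : ℝ)} := by
  intro Ix Ac AA P1
  have hτ : (Δt : ℂ) ≠ 0 := Complex.ofReal_ne_zero.mpr hΔt.ne'
  have hN : 1 ≤ Nt := by omega
  have hmap : (1 + ((Δt : ℂ) ^ 2 / 2) • Ac) =
      ((1 : Matrix (Fin Nx) (Fin Nx) ℝ) + (Δt ^ 2 / 2) • A).map Complex.ofRealHom := by
    ext i j
    by_cases hij : i = j <;> simp [Ac, hij]
  have hherm : (1 + ((Δt : ℂ) ^ 2 / 2) • Ac).IsHermitian := by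
    have hD : ((1 : Matrix (Fin Nx) (Fin Nx) ℝ) + (Δt ^ 2 / 2) • A).IsHermitian := by
      refine Matrix.isHermitian_one.add ?_
      rw [Matrix.IsHermitian, Matrix.conjTranspose_smul, hA.isHermitian.eq, star_trivial]
    rw [hmap]
    exact hD.map _ fun x => by simp
  have hchar : (1 + ((Δt : ℂ) ^ 2 / 2) • Ac).charpoly = ∏ j, (X - C (lam j : ℂ)) := by
    rw [hmap, Matrix.charpoly_map, hlam, Polynomial.map_prod]
    simp
  have hcos (j : Fin Nx) : lam j * Real.cos (θ j) = 1 := by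
    rw [hθ]
    exact mul_cos_arctan_sqrt (hlam1 j).le
  have hdet := det_leapfrogPreconditioner_eq_zero_iff hN hτ hherm hchar hcos
  have hne' (j : Fin Nx) : Complex.exp (-(Complex.I * Nt * θ j)) ≠ 1 := by
    rw [Complex.exp_neg, Ne, inv_eq_one]
    exact hne j
  have hP1 : P1 = leapfrogPreconditioner Nt Δt Ac 1 := rfl
  have hAA : AA = leapfrogPreconditioner Nt Δt Ac 0 := by
    rw [leapfrogPreconditioner, downShiftAlpha_eq, zero_smul, add_zero]
  have hP1det : IsUnit P1.det := by
    rw [isUnit_iff_ne_zero, Ne, hP1, hdet]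
    rintro ⟨j, h | h⟩
    · exact hne j h.symm
    · exact hne' j h.symm
  refine ⟨(Matrix.isUnit_iff_isUnit_det _).mpr hP1det, Set.ext fun z => ?_⟩
  have hspec : z ∈ spectrum ℂ (P1⁻¹ * AA) ↔ (z • P1 - AA).det = 0 := by
    have hfac : z • P1 - AA = P1 * (algebraMap ℂ _ z - P1⁻¹ * AA) := by
      rw [mul_sub, Matrix.mul_nonsing_inv_cancel_left _ _ hP1det, Algebra.algebraMap_eq_smul_one,
        Matrix.mul_smul, mul_one]
    rw [spectrum.mem_iff, Matrix.isUnit_iff_isUnit_det, isUnit_iff_ne_zero, not_not, hfac,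
      Matrix.det_mul, mul_eq_zero, or_iff_right hP1det.ne_zero]
  rw [hspec, hP1, hAA]
  by_cases hz : z = 1
  · have : Nonempty (Fin Nx) := ⟨⟨0, hNx⟩⟩
    simp [hz, det_leapfrogPreconditioner_one_sub_zero hNt]
  have hcast (j : Fin Nx) : Complex.I * Nt * θ j = Complex.I * ((Nt * θ j : ℝ) : ℂ) := by
    push_cast
    ring
  rw [smul_leapfrogPreconditioner_sub (by omega) _ _ hz, Matrix.det_smul, mul_eq_zero,
    or_iff_right (pow_ne_zero _ (sub_ne_zero.mpr hz)), hdet, Set.mem_union, Set.mem_singleton_iff,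
    or_iff_right hz, Set.mem_ofPred_eq]
  refine exists_congr fun j => ?_
  have h1 := hne j
  have h2 := hne' j
  rw [hcast] at h1 h2
  rw [hcast, half_sub_cot_eq h1, half_add_cot_eq h2, div_sub_one_eq_iff hz h1,
    div_sub_one_eq_iff hz h2, or_comm]
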